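/- arXiv:1501.04419 — 2 statements merged into one kernel-verified Lean document; each statement's English description precedes it below -/
import Mathlib

section
/- Let n, m ≥ 1, let S = (ℤ/nℤ) × (ℤ/mℤ) be the n×m torus lattice, fix a nonempty template Λ0 ⊆ S whose nm translates Λ0 ⊕ (t,u), (t,u) ∈ S, are pairwise distinct, and let 𝓛_m = {Λ0 ⊕ (t,u) : (t,u) ∈ S} and 𝓛 = {λ ⊆ S : λ ⊆ Λ for some Λ ∈ 𝓛_m}. Let (φ^λ)_{λ∈𝓛} be a constrained potential parametrisation, with energy U_φ(x) = Σ_{Λ∈𝓛_m} φ^{{s∈Λ : x_s = 1}} and Gibbs distribution p(x) = exp(U_φ(x)) / Σ_y exp(U_φ(y)). Then p is stationary, i.e. p(1^A) = p(1^{A⊕(t,u)}) for all A ⊆ S and (t,u) ∈ S, if and only if φ is translational invariant, i.e. φ^λ = φ^{λ⊕(t,u)} for all λ ∈ 𝓛 and (t,u) ∈ S. -/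
open Finset

/-- The translate `A ⊕ (t,u)` of a subset `A` of the torus lattice
`(ℤ/nℤ) × (ℤ/mℤ)` by a vector `v = (t,u)`. -/
def transl {n m : ℕ} (A : Finset (ZMod n × ZMod m)) (v : ZMod n × ZMod m) :
    Finset (ZMod n × ZMod m) :=
  A.image (fun p => p + v)

/-- The binary configuration `1^A`: equal to `1` on `A` and `0` elsewhere. -/
def indic {S : Type*} [DecidableEq S] (A : Finset S) : S → Fin 2 :=
  fun s => if s ∈ A then 1 else 0

/-- The energy of a constrained potential parametrisation `φ` relative to the family
of maximal cliques `Lm`: `U_φ(x) = Σ_{Λ ∈ Lm} φ^{{s ∈ Λ : x_s = 1}}`. -/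
def energyPhi {S : Type*} [DecidableEq S] (Lm : Finset (Finset S))
    (φ : Finset S → ℝ) (x : S → Fin 2) : ℝ :=
  ∑ Λ ∈ Lm, φ (Λ.filter (fun s => x s = 1))

/-- The Gibbs distribution associated with an energy function `U`:
`p(x) = exp(U(x)) / Σ_y exp(U(y))`. -/
noncomputable def gibbs {S : Type*} [Fintype S] [DecidableEq S]
    (U : (S → Fin 2) → ℝ) (x : S → Fin 2) : ℝ :=
  Real.exp (U x) / ∑ y : S → Fin 2, Real.exp (U y)

theorem energyPhi_indic {S : Type*} [DecidableEq S] (Lm : Finset (Finset S))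
    (φ : Finset S → ℝ) (A : Finset S) :
    energyPhi Lm φ (indic A) = ∑ Λ ∈ Lm, φ (Λ ∩ A) := by
  refine Finset.sum_congr rfl fun Λ _ => congrArg φ ?_
  ext s
  by_cases h : s ∈ A <;> simp [indic, h]

/-- The Gibbs distribution has equal values exactly where the energy does. -/
theorem gibbs_eq_gibbs_iff {S : Type*} [Fintype S] [DecidableEq S]
    (U : (S → Fin 2) → ℝ) (x y : S → Fin 2) : gibbs U x = gibbs U y ↔ U x = U y := by
  have hZ : (∑ z : S → Fin 2, Real.exp (U z)) ≠ 0 :=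
    (Finset.sum_pos (fun z _ => Real.exp_pos (U z)) Finset.univ_nonempty).ne'
  rw [gibbs, gibbs, div_left_inj' hZ, Real.exp_eq_exp]

/-- A constrained potential parametrisation is determined on cliques by its energy. -/
theorem eq_of_sum_inter_eq {S : Type*} [DecidableEq S] (Lm : Finset (Finset S))
    (φ ψ : Finset S → ℝ) (h : ∀ A, ∑ Λ ∈ Lm, φ (Λ ∩ A) = ∑ Λ ∈ Lm, ψ (Λ ∩ A))
    (lam : Finset S) (hlam : ∃ Λ ∈ Lm, lam ⊆ Λ) : φ lam = ψ lam := by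
  induction lam using Finset.strongInduction with
  | H lam ih =>
    obtain ⟨Λ₁, hΛ₁, hsub⟩ := hlam
    by_contra hne
    have hterm : ∀ Λ ∈ Lm, φ (Λ ∩ lam) - ψ (Λ ∩ lam)
        = if lam ⊆ Λ then φ lam - ψ lam else 0 := by
      intro Λ hΛ
      split_ifs with hs
      · rw [Finset.inter_eq_right.mpr hs]
      · refine sub_eq_zero.mpr (ih _ ?_ ⟨Λ, hΛ, Finset.inter_subset_left⟩)
        exact Finset.inter_subset_right.ssubset_of_ne
          fun he => hs (Finset.inter_eq_right.mp he)
    have hsum := sub_eq_zero.mpr (h lam)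
    rw [← Finset.sum_sub_distrib, Finset.sum_congr rfl hterm, ← Finset.sum_filter,
      Finset.sum_const, smul_eq_zero, Finset.card_eq_zero] at hsum
    rcases hsum with hempty | hzero
    · exact Finset.notMem_empty Λ₁ (hempty ▸ Finset.mem_filter.mpr ⟨hΛ₁, hsub⟩)
    · exact hne (sub_eq_zero.mp hzero)

theorem transl_transl {n m : ℕ} (A : Finset (ZMod n × ZMod m)) (v w : ZMod n × ZMod m) :
    transl (transl A v) w = transl A (v + w) := by
  simp only [transl, Finset.image_image, Function.comp_def, add_assoc]

theorem transl_zero {n m : ℕ} (A : Finset (ZMod n × ZMod m)) : transl A 0 = A := by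
  simp [transl]

theorem transl_inter {n m : ℕ} (A B : Finset (ZMod n × ZMod m)) (v : ZMod n × ZMod m) :
    transl (A ∩ B) v = transl A v ∩ transl B v :=
  Finset.image_inter _ _ (add_left_injective v)

/-- Translating a configuration amounts to translating the potential, when the family of
maximal cliques is closed under translation. -/
theorem sum_inter_transl {n m : ℕ} (Lm : Finset (Finset (ZMod n × ZMod m)))
    (hLm : ∀ Λ ∈ Lm, ∀ v, transl Λ v ∈ Lm) (φ : Finset (ZMod n × ZMod m) → ℝ)
    (A : Finset (ZMod n × ZMod m)) (v : ZMod n × ZMod m) :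
    ∑ Λ ∈ Lm, φ (Λ ∩ transl A v) = ∑ Λ ∈ Lm, φ (transl (Λ ∩ A) v) := by
  symm
  refine Finset.sum_nbij' (fun Λ => transl Λ v) (fun Λ => transl Λ (-v))
    (fun Λ hΛ => hLm Λ hΛ v) (fun Λ hΛ => hLm Λ hΛ (-v)) ?_ ?_ ?_
  · intro Λ _
    simp [transl_transl, transl_zero]
  · intro Λ _
    simp [transl_transl, transl_zero]
  · intro Λ _
    rw [transl_inter]

/-- On the `n × m` torus with maximal cliques the (pairwise distinct) translates of a
nonempty template `Λ0`, the Gibbs distribution of a constrained potential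
parametrisation `φ` is stationary if and only if `φ` is translational invariant. -/
theorem stmt2 (n m : ℕ) [NeZero n] [NeZero m]
    (Λ0 : Finset (ZMod n × ZMod m)) (hΛ0 : Λ0.Nonempty)
    (hinj : Function.Injective (fun v : ZMod n × ZMod m => transl Λ0 v))
    (Lm : Finset (Finset (ZMod n × ZMod m)))
    (hLm : ∀ Λ : Finset (ZMod n × ZMod m),
      Λ ∈ Lm ↔ ∃ v : ZMod n × ZMod m, Λ = transl Λ0 v)
    (L : Finset (Finset (ZMod n × ZMod m)))
    (hL : ∀ lam : Finset (ZMod n × ZMod m), lam ∈ L ↔ ∃ Λ ∈ Lm, lam ⊆ Λ)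
    (φ : Finset (ZMod n × ZMod m) → ℝ) :
    (∀ (A : Finset (ZMod n × ZMod m)) (v : ZMod n × ZMod m),
        gibbs (energyPhi Lm φ) (indic A) = gibbs (energyPhi Lm φ) (indic (transl A v)))
      ↔ (∀ lam ∈ L, ∀ v : ZMod n × ZMod m, φ lam = φ (transl lam v)) := by
  have hclosed : ∀ Λ ∈ Lm, ∀ v, transl Λ v ∈ Lm := by
    intro Λ hΛ v
    obtain ⟨w, rfl⟩ := (hLm Λ).mp hΛ
    exact (hLm _).mpr ⟨w + v, transl_transl Λ0 w v⟩
  simp only [gibbs_eq_gibbs_iff, energyPhi_indic, sum_inter_transl Lm hclosed]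
  constructor
  · intro h lam hlam v
    exact eq_of_sum_inter_eq Lm φ (fun B => φ (transl B v)) (fun A => h A v) lam
      ((hL lam).mp hlam)
  · intro h A v
    exact Finset.sum_congr rfl fun Λ hΛ =>
      h _ ((hL _).mpr ⟨Λ, hΛ, Finset.inter_subset_left⟩) v
end

section
/- Let n, m ≥ 1, let S = (ℤ/nℤ) × (ℤ/mℤ) be the n×m torus lattice, fix a nonempty template Λ0 ⊆ S whose nm translates Λ0 ⊕ (t,u), (t,u) ∈ S, are pairwise distinct, and let 𝓛_m = {Λ0 ⊕ (t,u) : (t,u) ∈ S} and 𝓛 = {λ ⊆ S : λ ⊆ Λ for some Λ ∈ 𝓛_m}. Let (φ^λ)_{λ∈𝓛} be a constrained potential parametrisation and let (β^λ)_{λ⊆S} be the multilinear coefficients of the energy U_φ(x) = Σ_{Λ∈𝓛_m} φ^{{s∈Λ : x_s = 1}}. Then φ^λ = φ^{λ⊕(t,u)} for all λ ∈ 𝓛 and (t,u) ∈ S if and only if β^λ = β^{λ⊕(t,u)} for all λ ⊆ S and (t,u) ∈ S. -/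
open Finset

/-- A permutation leaves the subset sums of `β` invariant iff it leaves `β` invariant. -/
theorem sum_powerset_map_eq_iff {S : Type*} (σ : Equiv.Perm S) (β : Finset S → ℝ) :
    (∀ A : Finset S, ∑ C ∈ A.powerset, β C = ∑ C ∈ (A.map σ.toEmbedding).powerset, β C)
      ↔ ∀ A : Finset S, β A = β (A.map σ.toEmbedding) := by
  classical
  have key (A : Finset S) : ∑ C ∈ (A.map σ.toEmbedding).powerset, β C
      = ∑ C ∈ A.powerset, β (C.map σ.toEmbedding) :=
    (Finset.sum_equiv σ.finsetCongr (by simp) (by simp)).symm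
  simp only [key]
  refine ⟨fun h A => ?_, fun h A => Finset.sum_congr rfl fun C _ => h C⟩
  induction A using Finset.strongInduction with
  | H A ih =>
    have hA := h A
    rw [← Finset.add_sum_erase _ _ (Finset.mem_powerset_self A),
      ← Finset.add_sum_erase _ _ (Finset.mem_powerset_self A),
      Finset.sum_congr rfl fun C hC => ih C ?_] at hA
    · exact add_right_cancel hA
    · rw [Finset.mem_erase, Finset.mem_powerset] at hC
      exact hC.2.ssubset_of_ne hC.1

/-- A permutation preserving the family `Lm` leaves the energy of `φ` invariant iff it leaves
`φ` invariant on the subsets of members of `Lm`. -/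
theorem sum_inter_map_eq_iff {S : Type*} [DecidableEq S] (σ : Equiv.Perm S)
    (Lm : Finset (Finset S)) (hσ : ∀ Λ, Λ ∈ Lm ↔ Λ.map σ.toEmbedding ∈ Lm)
    (φ : Finset S → ℝ) :
    (∀ A : Finset S, ∑ Λ ∈ Lm, φ (A ∩ Λ) = ∑ Λ ∈ Lm, φ (A.map σ.toEmbedding ∩ Λ))
      ↔ ∀ A : Finset S, (∃ Λ ∈ Lm, A ⊆ Λ) → φ A = φ (A.map σ.toEmbedding) := by
  have key (A : Finset S) : ∑ Λ ∈ Lm, φ (A.map σ.toEmbedding ∩ Λ)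
      = ∑ Λ ∈ Lm, φ ((A ∩ Λ).map σ.toEmbedding) :=
    (Finset.sum_equiv σ.finsetCongr (by simpa using hσ)
      (by simp [Finset.map_inter])).symm
  simp only [key]
  refine ⟨fun h A => ?_, fun h A => Finset.sum_congr rfl fun Λ hΛ =>
    h _ ⟨Λ, hΛ, Finset.inter_subset_right⟩⟩
  induction A using Finset.strongInduction with
  | H A ih =>
    rintro ⟨Λ₀, hΛ₀, hAΛ₀⟩
    by_contra hne
    have hzero : ∑ Λ ∈ Lm, (φ (A ∩ Λ) - φ ((A ∩ Λ).map σ.toEmbedding)) = 0 := by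
      rw [Finset.sum_sub_distrib, h A, sub_self]
    have hterm : ∀ Λ ∈ Lm, φ (A ∩ Λ) - φ ((A ∩ Λ).map σ.toEmbedding)
        = if A ⊆ Λ then φ A - φ (A.map σ.toEmbedding) else 0 := by
      intro Λ hΛ
      split_ifs with hA
      · rw [Finset.inter_eq_left.2 hA]
      · exact sub_eq_zero.2 (ih _
          (Finset.inter_subset_left.ssubset_of_ne fun he => hA (Finset.inter_eq_left.1 he))
          ⟨Λ, hΛ, Finset.inter_subset_right⟩)
    rw [Finset.sum_congr rfl hterm, ← Finset.sum_filter, Finset.sum_const, smul_eq_zero] at hzero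
    rcases hzero with hcard | hdiff
    · exact Finset.notMem_empty Λ₀ (Finset.card_eq_zero.1 hcard ▸
        Finset.mem_filter.2 ⟨hΛ₀, hAΛ₀⟩)
    · exact hne (sub_eq_zero.1 hdiff)

theorem transl_eq_map {n m : ℕ} (A : Finset (ZMod n × ZMod m)) (v : ZMod n × ZMod m) :
    transl A v = A.map (Equiv.addRight v).toEmbedding := by
  rw [transl, Finset.map_eq_image]
  rfl

/-- The values of the energy on indicator configurations, in terms of its multilinear
coefficients. -/
theorem sum_inter_eq_sum_powerset {S : Type*} [Fintype S] [DecidableEq S]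
    (Lm : Finset (Finset S)) (φ β : Finset S → ℝ)
    (hβ : ∀ x : S → Fin 2,
      energyPhi Lm φ x = ∑ lam : Finset S, β lam * ∏ s ∈ lam, ((x s : ℕ) : ℝ))
    (A : Finset S) : ∑ Λ ∈ Lm, φ (A ∩ Λ) = ∑ C ∈ A.powerset, β C := by
  have h := hβ fun s => if s ∈ A then 1 else 0
  have hfilter (Λ : Finset S) :
      Λ.filter (fun s => (if s ∈ A then (1 : Fin 2) else 0) = 1) = A ∩ Λ := by
    ext s
    by_cases hs : s ∈ A <;> simp [hs]
  have hprod (C : Finset S) :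
      ∏ s ∈ C, (((if s ∈ A then (1 : Fin 2) else 0 : Fin 2) : ℕ) : ℝ)
        = if C ⊆ A then 1 else 0 := by
    have hcast (s : S) : (((if s ∈ A then (1 : Fin 2) else 0 : Fin 2) : ℕ) : ℝ)
        = if s ∈ A then 1 else 0 := by
      split_ifs <;> simp
    simp only [hcast, Finset.prod_ite_zero, Finset.prod_const_one, Finset.subset_iff]
  simp only [energyPhi, hfilter, hprod, mul_ite, mul_one, mul_zero] at h
  rw [h, ← Finset.sum_filter]
  exact Finset.sum_congr (by ext; simp) fun _ _ => rfl

/-- On the `n × m` torus with maximal cliques the (pairwise distinct) translates of a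
nonempty template `Λ0`, a constrained potential parametrisation `φ` is translational
invariant if and only if the multilinear coefficients `β` of its energy `U_φ` are
translational invariant. -/
theorem stmt3 (n m : ℕ) [NeZero n] [NeZero m]
    (Λ0 : Finset (ZMod n × ZMod m)) (hΛ0 : Λ0.Nonempty)
    (hinj : Function.Injective (fun v : ZMod n × ZMod m => transl Λ0 v))
    (Lm : Finset (Finset (ZMod n × ZMod m)))
    (hLm : ∀ Λ : Finset (ZMod n × ZMod m),
      Λ ∈ Lm ↔ ∃ v : ZMod n × ZMod m, Λ = transl Λ0 v)
    (L : Finset (Finset (ZMod n × ZMod m)))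
    (hL : ∀ lam : Finset (ZMod n × ZMod m), lam ∈ L ↔ ∃ Λ ∈ Lm, lam ⊆ Λ)
    (φ : Finset (ZMod n × ZMod m) → ℝ)
    (β : Finset (ZMod n × ZMod m) → ℝ)
    (hβ : ∀ x : ZMod n × ZMod m → Fin 2,
      energyPhi Lm φ x
        = ∑ lam : Finset (ZMod n × ZMod m), β lam * ∏ s ∈ lam, ((x s : ℕ) : ℝ)) :
    (∀ lam ∈ L, ∀ v : ZMod n × ZMod m, φ lam = φ (transl lam v))
      ↔ (∀ (lam : Finset (ZMod n × ZMod m)) (v : ZMod n × ZMod m),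
          β lam = β (transl lam v)) := by
  have hmem (v : ZMod n × ZMod m) (Λ : Finset (ZMod n × ZMod m)) :
      Λ ∈ Lm ↔ Λ.map (Equiv.addRight v).toEmbedding ∈ Lm := by
    rw [← transl_eq_map, hLm, hLm]
    constructor
    · rintro ⟨w, rfl⟩
      exact ⟨w + v, transl_transl _ _ _⟩
    · rintro ⟨w, hw⟩
      refine ⟨w + -v, ?_⟩
      rw [← transl_transl, ← hw, transl_transl, add_neg_cancel]
      simp [transl]
  have hiff (v : ZMod n × ZMod m) :=
    (sum_inter_map_eq_iff (Equiv.addRight v) Lm (hmem v) φ).symm.trans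
      ((forall_congr' fun A => by
        rw [sum_inter_eq_sum_powerset Lm φ β hβ, sum_inter_eq_sum_powerset Lm φ β hβ]).trans
        (sum_powerset_map_eq_iff (Equiv.addRight v) β))
  simp only [← transl_eq_map, ← hL] at hiff
  exact ⟨fun h lam v => (hiff v).1 (fun A hA => h A hA v) lam,
    fun h lam hlam v => (hiff v).2 (fun A => h A v) lam hlam⟩
end
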